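/- Achievability of the postselected tilted correlations for each Bell state: for every real δ, with observables A₀ = σz, A₁ = σx·cos δ − σz·sin δ, C₀ = σx, C₁ = σz·cos δ − σx·sin δ, and with the Bell states labeled Φ^{(0,0)} = Φ⁺, Φ^{(1,0)} = Ψ⁺, Φ^{(0,1)} = Φ⁻, Φ^{(1,1)} = Ψ⁻, the following hold for every b = (b₀,b₁) ∈ {0,1}²: ⟨Φ^b|(A₀⊗C₀)|Φ^b⟩ = 0, ⟨Φ^b|(A₀⊗C₁)|Φ^b⟩ = (−1)^{b₀}·cos δ, ⟨Φ^b|(A₁⊗C₀)|Φ^b⟩ = (−1)^{b₁}·cos δ, and ⟨Φ^b|(A₁⊗C₁)|Φ^b⟩ = −[b₀=b₁]·(−1)^{b₀}·sin 2δ (where [b₀=b₁] is 1 if b₀=b₁ and 0 otherwise); moreover all single-party expectations ⟨Φ^b|(A_x⊗I₂)|Φ^b⟩ and ⟨Φ^b|(I₂⊗C_z)|Φ^b⟩ vanish for x,z ∈ {0,1}. -/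

import Mathlib

open Matrix Kronecker

noncomputable section

abbrev M2 := Matrix (Fin 2) (Fin 2) ℂ
abbrev M4 := Matrix (Fin 2 × Fin 2) (Fin 2 × Fin 2) ℂ
abbrev Quad := Fin 2 × Fin 2 × Fin 2 × Fin 2
abbrev M16 := Matrix Quad Quad ℂ

/-- Pauli Z matrix. -/
def σz : M2 := !![1, 0; 0, -1]
/-- Pauli X matrix. -/
def σx : M2 := !![0, 1; 1, 0]

/-- The complex number 1/√2. -/
def invSqrt2 : ℂ := ((Real.sqrt 2 : ℝ) : ℂ)⁻¹

/-- Bell state Φ⁺ = (|00⟩+|11⟩)/√2. -/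
def PhiP : Fin 2 × Fin 2 → ℂ := fun p =>
  if p = (0, 0) then invSqrt2 else if p = (1, 1) then invSqrt2 else 0
/-- Bell state Φ⁻ = (|00⟩−|11⟩)/√2. -/
def PhiM : Fin 2 × Fin 2 → ℂ := fun p =>
  if p = (0, 0) then invSqrt2 else if p = (1, 1) then -invSqrt2 else 0
/-- Bell state Ψ⁺ = (|01⟩+|10⟩)/√2. -/
def PsiP : Fin 2 × Fin 2 → ℂ := fun p =>
  if p = (0, 1) then invSqrt2 else if p = (1, 0) then invSqrt2 else 0
/-- Bell state Ψ⁻ = (|01⟩−|10⟩)/√2. -/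
def PsiM : Fin 2 × Fin 2 → ℂ := fun p =>
  if p = (0, 1) then invSqrt2 else if p = (1, 0) then -invSqrt2 else 0

/-- Rank-one projector |ψ⟩⟨ψ|. -/
def proj {n : Type*} (ψ : n → ℂ) : Matrix n n ℂ := vecMulVec ψ (star ψ)

/-- The four Bell states, ordered Φ⁺, Φ⁻, Ψ⁺, Ψ⁻. -/
def Bell : Fin 4 → (Fin 2 × Fin 2 → ℂ) := ![PhiP, PhiM, PsiP, PsiM]

/-- Projectors onto the Bell states. -/
def P (b : Fin 4) : M4 := proj (Bell b)

/-- Kronecker product M_A ⊗ M_{B₁B₂} ⊗ M_C, in the tensor ordering A, B₁, B₂, C. -/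
def kron3 (MA : M2) (MB : M4) (MC : M2) : M16 := fun p q =>
  MA p.1 q.1 * MB (p.2.1, p.2.2.1) (q.2.1, q.2.2.1) * MC p.2.2.2 q.2.2.2

/-- The two-singlet state vector |Ψ⁻⟩_{AB₁} ⊗ |Ψ⁻⟩_{B₂C}. -/
def twoSinglets : Quad → ℂ := fun p => PsiM (p.1, p.2.1) * PsiM (p.2.2.1, p.2.2.2)

/-- The density matrix ρ = |Ψ⁻⟩⟨Ψ⁻| ⊗ |Ψ⁻⟩⟨Ψ⁻| on A, B₁, B₂, C. -/
def ρ₂ : M16 := proj twoSinglets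

/-- Spectral projectors Πˣ_a = ½(I₂ + (−1)^a (σz + (−1)^x σx)/√2) of the
observables (σz ± σx)/√2. -/
def Proj (x a : Fin 2) : M2 :=
  (1 / 2 : ℂ) • ((1 : M2) + (((-1 : ℂ) ^ (a : ℕ)) * invSqrt2) • (σz + ((-1 : ℂ) ^ (x : ℕ)) • σx))

/-- Eigenprojectors Qʸ_s = ½(I₄ + (−1)^s σ⊗σ) of σz⊗σz (y = 0) and σx⊗σx (y = 1);
s = 0 is the "+" projector and s = 1 the "−" projector. -/
def Q (y s : Fin 2) : M4 :=
  (1 / 2 : ℂ) • ((1 : M4) + ((-1 : ℂ) ^ (s : ℕ)) • (if y = 0 then σz ⊗ₖ σz else σx ⊗ₖ σx))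

/-- Correlator ⟨ψ|(A ⊗ C)|ψ⟩ of two single-qubit observables on a two-qubit state. -/
def corr (ψ : Fin 2 × Fin 2 → ℂ) (A C : M2) : ℂ := star ψ ⬝ᵥ ((A ⊗ₖ C) *ᵥ ψ)
/-- Alice's tilted observables A₀ = σz, A₁ = σx cos δ − σz sin δ. -/
def A' (δ : ℝ) : Fin 2 → M2 :=
  ![σz, (Real.cos δ : ℂ) • σx - (Real.sin δ : ℂ) • σz]

/-- Charlie's tilted observables C₀ = σx, C₁ = σz cos δ − σx sin δ. -/
def C' (δ : ℝ) : Fin 2 → M2 :=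
  ![σx, (Real.cos δ : ℂ) • σz - (Real.sin δ : ℂ) • σx]

/-- The Bell states labeled by b = (b₀,b₁): Φ^{(0,0)} = Φ⁺, Φ^{(1,0)} = Ψ⁺,
Φ^{(0,1)} = Φ⁻, Φ^{(1,1)} = Ψ⁻. -/
def BellB : Fin 2 × Fin 2 → (Fin 2 × Fin 2 → ℂ) := fun b =>
  if b = (0, 0) then PhiP else if b = (1, 0) then PsiP
  else if b = (0, 1) then PhiM else PsiM

theorem invSqrt2_sq_aux : invSqrt2 * invSqrt2 = 1 / 2 := by
  unfold invSqrt2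
  rw [← mul_inv, ← Complex.ofReal_mul, Real.mul_self_sqrt (by norm_num)]
  norm_num

theorem invSqrt2_star_aux : (starRingEnd ℂ) invSqrt2 = invSqrt2 := by
  unfold invSqrt2
  rw [map_inv₀, Complex.conj_ofReal]

theorem corr_expand_aux (ψ : Fin 2 × Fin 2 → ℂ) (A C : M2) : corr ψ A C =
    ∑ i : Fin 2, ∑ j : Fin 2, (starRingEnd ℂ) (ψ (i, j)) *
      ∑ k : Fin 2, ∑ l : Fin 2, A i k * C j l * ψ (k, l) := by
  simp only [corr, dotProduct, mulVec, Fintype.sum_prod_type, kroneckerMap_apply, Pi.star_apply]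
  rfl

/-- Achievability of the postselected tilted correlations for each Bell state
Φ^b, b = (b₀,b₁): ⟨A₀C₀⟩_b = 0, ⟨A₀C₁⟩_b = (−1)^{b₀} cos δ,
⟨A₁C₀⟩_b = (−1)^{b₁} cos δ, ⟨A₁C₁⟩_b = −[b₀=b₁](−1)^{b₀} sin 2δ, and all
single-party expectations vanish. -/
theorem tilted_correlations_achievable_bell (δ : ℝ) (b : Fin 2 × Fin 2) :
    corr (BellB b) (A' δ 0) (C' δ 0) = 0 ∧
    corr (BellB b) (A' δ 0) (C' δ 1) = (-1 : ℂ) ^ (b.1 : ℕ) * (Real.cos δ : ℂ) ∧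
    corr (BellB b) (A' δ 1) (C' δ 0) = (-1 : ℂ) ^ (b.2 : ℕ) * (Real.cos δ : ℂ) ∧
    corr (BellB b) (A' δ 1) (C' δ 1) =
      -((if b.1 = b.2 then (1 : ℂ) else 0) * (-1 : ℂ) ^ (b.1 : ℕ) * (Real.sin (2 * δ) : ℂ)) ∧
    (∀ x : Fin 2, corr (BellB b) (A' δ x) 1 = 0) ∧
    (∀ z : Fin 2, corr (BellB b) 1 (C' δ z) = 0) := by
  have h := invSqrt2_sq_aux
  have hs := invSqrt2_star_aux
  have h2 : (Real.sin (2 * δ) : ℂ) = 2 * (Real.sin δ : ℂ) * (Real.cos δ : ℂ) := by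
    rw [Real.sin_two_mul]; push_cast; ring
  rw [h2]
  generalize hc : (Real.cos δ : ℂ) = c
  generalize hd : (Real.sin δ : ℂ) = d
  obtain ⟨b0, b1⟩ := b
  simp only [Fin.forall_fin_two, corr_expand_aux, A', C', hc, hd]
  fin_cases b0 <;> fin_cases b1 <;>
    simp [BellB, PhiP, PhiM, PsiP, PsiM, σx, σz, Fin.sum_univ_two, hs, Matrix.one_apply] <;>
    grind
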